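/- Let W be the set of matrix fields u : ℝ³ → ℝ^{3×3} of the form u(x) = V + x × Σ with V ∈ 𝕋 and Σ ∈ 𝕊. Then: (i) for every S ∈ 𝕊 there exists u ∈ W such that sym((curl u)(x)) = S for all x ∈ ℝ³ (i.e., sym∘curl maps W onto the constant 𝕊-valued fields); and (ii) an element u ∈ W satisfies sym((curl u)(x)) = 0 for all x if and only if there is an affine vector field v : ℝ³ → ℝ³, v(x) = A x + b with A ∈ ℝ^{3×3}, b ∈ ℝ³, such that u(x) = dev(Dv(x)) = dev A for all x; equivalently, if and only if u is a constant 𝕋-valued field. (This is the exactness of the polynomial sequence 𝒫₁⊗𝕍 →^{dev grad} 𝒫₀⊗𝕋 + x×(𝒫₀⊗𝕊) →^{sym curl} 𝒫₀⊗𝕊.) -/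

import Mathlib

open Matrix

noncomputable section

/-- Euclidean 3-space. -/
abbrev E3 := EuclideanSpace ℝ (Fin 3)

/-- View a Euclidean vector as a plain function `Fin 3 → ℝ`. -/
def tov (x : E3) : Fin 3 → ℝ := x

/-- The Levi-Civita symbol on `Fin 3`. -/
def eps (i j k : Fin 3) : ℝ :=
  ((((j : ℤ) - (i : ℤ)) * ((k : ℤ) - (i : ℤ)) * ((k : ℤ) - (j : ℤ)) : ℤ) : ℝ) / 2

/-- Partial derivative in the `i`-th coordinate direction. -/
def pd (i : Fin 3) (f : E3 → ℝ) (x : E3) : ℝ := fderiv ℝ f x (EuclideanSpace.single i 1)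

/-- Row-wise curl of a matrix field: `(curl σ)_{ij} = ∑_{k,l} ε_{jkl} ∂_k σ_{il}`. -/
def mcurl (σ : E3 → Matrix (Fin 3) (Fin 3) ℝ) (x : E3) : Matrix (Fin 3) (Fin 3) ℝ :=
  Matrix.of fun i j => ∑ k, ∑ l, eps j k l * pd k (fun y => σ y i l) x

/-- `x × M`: the matrix whose `j`-th column is the cross product of `x` with the
`j`-th column of `M`. -/
def crossMat (x : E3) (M : Matrix (Fin 3) (Fin 3) ℝ) : Matrix (Fin 3) (Fin 3) ℝ :=
  Matrix.of fun i j => crossProduct (tov x) (fun r => M r j) i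

/-- Symmetric part of a matrix. -/
def symm3 (A : Matrix (Fin 3) (Fin 3) ℝ) : Matrix (Fin 3) (Fin 3) ℝ := (2⁻¹ : ℝ) • (A + Aᵀ)

/-- Deviatoric (trace-free) part of a matrix. -/
def devm (A : Matrix (Fin 3) (Fin 3) ℝ) : Matrix (Fin 3) (Fin 3) ℝ :=
  A - (A.trace / 3) • (1 : Matrix (Fin 3) (Fin 3) ℝ)

/-- The entries of `V + y × M` are affine in `y`, with partial derivatives `(eₖ × M)ᵢₗ`. -/
lemma pd_add_crossMat (V M : Matrix (Fin 3) (Fin 3) ℝ) (i k l : Fin 3) (x : E3) :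
    pd k (fun y => (V + crossMat y M) i l) x = crossMat (EuclideanSpace.single k 1) M i l := by
  let L : E3 →ₗ[ℝ] ℝ :=
    { toFun := fun y => crossMat y M i l
      map_add' := fun y z => by
        have h : tov (y + z) = tov y + tov z := rfl
        simp [crossMat, h]
      map_smul' := fun c y => by
        have h : tov (c • y) = c • tov y := rfl
        simp [crossMat, h] }
  have h : HasFDerivAt (fun y => (V + crossMat y M) i l) (LinearMap.toContinuousLinearMap L) x :=
    (LinearMap.toContinuousLinearMap L).hasFDerivAt.const_add (V i l)
  simp only [pd, h.fderiv]
  rfl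

/-- The row-wise curl of `V + y × M` is the constant `(tr M) I - Mᵀ`. -/
lemma mcurl_add_crossMat (V M : Matrix (Fin 3) (Fin 3) ℝ) (x : E3) :
    mcurl (fun y => V + crossMat y M) x = M.trace • (1 : Matrix (Fin 3) (Fin 3) ℝ) - Mᵀ := by
  ext i j
  simp only [mcurl, pd_add_crossMat, Matrix.of_apply]
  fin_cases i <;> fin_cases j <;>
    simp [crossMat, tov, eps, cross_apply, Fin.sum_univ_three, Matrix.trace] <;> ring

/-- For symmetric `M`, the symmetrized curl of `V + y × M` is `(tr M) I - M`. -/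
lemma symm3_mcurl_add_crossMat (V : Matrix (Fin 3) (Fin 3) ℝ) {M : Matrix (Fin 3) (Fin 3) ℝ}
    (hM : M.IsSymm) (x : E3) :
    symm3 (mcurl (fun y => V + crossMat y M) x) =
      M.trace • (1 : Matrix (Fin 3) (Fin 3) ℝ) - M := by
  rw [mcurl_add_crossMat, hM.eq, symm3, transpose_sub, transpose_smul, transpose_one, hM.eq,
    ← two_smul ℝ, smul_smul]
  norm_num

lemma mcurl_const (B : Matrix (Fin 3) (Fin 3) ℝ) (x : E3) : mcurl (fun _ => B) x = 0 := by
  ext i j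
  simp [mcurl, pd]

/-- The linear map `M ↦ (tr M) I - M` on 3×3 matrices is injective. -/
lemma eq_zero_of_trace_smul_one_sub_eq_zero {M : Matrix (Fin 3) (Fin 3) ℝ}
    (h : M.trace • (1 : Matrix (Fin 3) (Fin 3) ℝ) - M = 0) : M = 0 := by
  have ht : M.trace = 0 := by
    have := congrArg Matrix.trace h
    simp only [trace_sub, trace_smul, trace_one, Fintype.card_fin, trace_zero, smul_eq_mul] at this
    push_cast at this
    linarith
  simpa [ht] using h

/-- **Exactness of the polynomial sequence
`𝒫₁⊗𝕍 →(dev grad) 𝒫₀⊗𝕋 + x×(𝒫₀⊗𝕊) →(sym curl) 𝒫₀⊗𝕊`.**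
(i) `sym ∘ curl` maps the fields `x ↦ V + x × S` (`V` trace-free, `S` symmetric)
onto the constant symmetric fields; (ii) such a field is in the kernel of
`sym ∘ curl` iff it is `dev` of the (constant) Jacobian of an affine vector field,
i.e. iff it is a constant trace-free field `dev A`. -/
theorem stmt2 :
    (∀ S : Matrix (Fin 3) (Fin 3) ℝ, S.IsSymm →
      ∃ (V Sg : Matrix (Fin 3) (Fin 3) ℝ), V.trace = 0 ∧ Sg.IsSymm ∧
        ∀ x : E3, symm3 (mcurl (fun y => V + crossMat y Sg) x) = S)
    ∧ (∀ V Sg : Matrix (Fin 3) (Fin 3) ℝ, V.trace = 0 → Sg.IsSymm →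
        ((∀ x : E3, symm3 (mcurl (fun y => V + crossMat y Sg) x) = 0) ↔
          ∃ A : Matrix (Fin 3) (Fin 3) ℝ, ∀ x : E3, V + crossMat x Sg = devm A)) := by
  refine ⟨fun S hS => ?_, fun V Sg hV hSg => ⟨fun h => ?_, ?_⟩⟩
  · have hSym : ((S.trace / 2) • (1 : Matrix (Fin 3) (Fin 3) ℝ) - S).IsSymm := by
      simp [Matrix.IsSymm, hS.eq]
    refine ⟨0, _, trace_zero _ _, hSym, fun x => ?_⟩
    have ht : ((S.trace / 2) • (1 : Matrix (Fin 3) (Fin 3) ℝ) - S).trace = S.trace / 2 := by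
      simp only [trace_sub, trace_smul, trace_one, Fintype.card_fin, smul_eq_mul]
      push_cast
      ring
    rw [symm3_mcurl_add_crossMat 0 hSym x, ht, sub_sub_cancel]
  · have h0 : Sg = 0 :=
      eq_zero_of_trace_smul_one_sub_eq_zero ((symm3_mcurl_add_crossMat V hSg 0).symm.trans (h 0))
    refine ⟨V, fun x => ?_⟩
    have hc : crossMat x 0 = 0 := by
      ext i j
      fin_cases i <;> simp [crossMat, cross_apply]
    rw [h0, hc, add_zero, devm, hV, zero_div, zero_smul, sub_zero]
  · rintro ⟨A, hA⟩ x
    rw [funext hA, mcurl_const]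
    simp [symm3]
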